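/- Let γ > 2 be an integer, let f : ℝ^d → ℝ^d be of class C^{γ+1}, and let K ⊂ ℝ^d be compact. Then as δ → 0⁺, φ_γ(·,δ) converges to f uniformly on K and the Fréchet derivative D_ξφ_γ(·,δ) converges to Df uniformly on K; that is, sup_{ξ∈K} ‖φ_γ(ξ,δ) − f(ξ)‖ → 0 and sup_{ξ∈K} ‖D_ξφ_γ(ξ,δ) − Df(ξ)‖ → 0 as δ → 0⁺. -/

import Mathlib

noncomputable section

variable {d : ℕ}

/-- `ϑ₁(X) := ∑_{k=0}^∞ X^k/(k+1)!` (and more generally `ϑ_j`) for a bounded linear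
operator `X` on `ℝ^d`. -/
def vartheta (j : ℕ) (X : EuclideanSpace ℝ (Fin d) →L[ℝ] EuclideanSpace ℝ (Fin d)) :
    EuclideanSpace ℝ (Fin d) →L[ℝ] EuclideanSpace ℝ (Fin d) :=
  ∑' k : ℕ, (((k + j).factorial : ℝ))⁻¹ • X ^ k

/-- `Φf(ξ,δ) := ϑ₁(δ·Df(ξ))(f(ξ))`. -/
def Phif (f : EuclideanSpace ℝ (Fin d) → EuclideanSpace ℝ (Fin d))
    (ξ : EuclideanSpace ℝ (Fin d)) (δ : ℝ) : EuclideanSpace ℝ (Fin d) :=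
  vartheta 1 (δ • fderiv ℝ f ξ) (f ξ)

/-- `q(ξ; δ, u) := f(ξ + δ·Φf(ξ,δ) + u) − δ·Df(ξ)(Φf(ξ,δ)) − f(ξ)`. -/
def qf (f : EuclideanSpace ℝ (Fin d) → EuclideanSpace ℝ (Fin d))
    (ξ : EuclideanSpace ℝ (Fin d)) (δ : ℝ) (u : EuclideanSpace ℝ (Fin d)) :
    EuclideanSpace ℝ (Fin d) :=
  f (ξ + δ • Phif f ξ δ + u) - δ • fderiv ℝ f ξ (Phif f ξ δ) - f ξ

/-- The Runge–Kutta stages `k_i(ξ,δ) := q(ξ; c_i·δ, δ·∑_{j<i} a_{ij}·k_j(ξ,δ))`. -/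
def kstage (f : EuclideanSpace ℝ (Fin d) → EuclideanSpace ℝ (Fin d))
    (c : ℕ → ℝ) (a : ℕ → ℕ → ℝ) (ξ : EuclideanSpace ℝ (Fin d)) (δ : ℝ) (i : ℕ) :
    EuclideanSpace ℝ (Fin d) :=
  Nat.strongRecOn i fun i ih =>
    qf f ξ (c i * δ) (δ • ∑ j : Fin i, a i (j : ℕ) • ih (j : ℕ) j.isLt)

/-- The LLRK increment map `φ_γ(ξ,δ) := Φf(ξ,δ) + ∑_{i=1}^s b_i·k_i(ξ,δ)`. -/
def phiGamma (f : EuclideanSpace ℝ (Fin d) → EuclideanSpace ℝ (Fin d))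
    (c : ℕ → ℝ) (a : ℕ → ℕ → ℝ) (b : ℕ → ℝ) (s : ℕ)
    (ξ : EuclideanSpace ℝ (Fin d)) (δ : ℝ) : EuclideanSpace ℝ (Fin d) :=
  Phif f ξ δ + ∑ i ∈ Finset.range s, b i • kstage f c a ξ δ i

open Filter Topology

section Uncurried

variable {E G H X : Type*} [NormedAddCommGroup E] [NormedSpace ℝ E]
  [NormedAddCommGroup G] [NormedSpace ℝ G] [NormedAddCommGroup H] [NormedSpace ℝ H]
  [NormedAddCommGroup X] [NormedSpace ℝ X] {F : E → G → H}

theorem ContDiff.comp_of_uncurried {n : WithTop ℕ∞}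
    (hF : ContDiff ℝ n fun p : E × G => F p.1 p.2) {u : X → E} {v : X → G}
    (hu : ContDiff ℝ n u) (hv : ContDiff ℝ n v) : ContDiff ℝ n fun x => F (u x) (v x) :=
  hF.comp (hu.prodMk hv)

/-- The partial derivative of a jointly `C^1` map in its first variable is jointly continuous. -/
theorem ContDiff.continuous_fderiv_left (hF : ContDiff ℝ 1 fun p : E × G => F p.1 p.2) :
    Continuous fun p : E × G => fderiv ℝ (fun x => F x p.2) p.1 := by
  have hF' : ContDiff ℝ 1 (Function.uncurry fun (p : E × G) x => F x p.2) :=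
    hF.comp_of_uncurried contDiff_snd (contDiff_snd.comp contDiff_fst)
  exact (hF'.fderiv (n := 0) contDiff_fst (by simp)).continuous

end Uncurried

theorem contDiff_vartheta (j : ℕ) (n : WithTop ℕ∞) :
    ContDiff ℝ n (vartheta (d := d) j) := by
  let A := EuclideanSpace ℝ (Fin d) →L[ℝ] EuclideanSpace ℝ (Fin d)
  let w : ℕ → ℝ := fun k => ((k + j).factorial : ℝ)⁻¹
  have hw : ∀ k, w k ≠ 0 := fun k => inv_ne_zero (by positivity)
  have hratio : Tendsto (fun k => ‖w k.succ‖ / ‖w k‖) atTop (𝓝 0) := by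
    have h := (tendsto_const_div_atTop_nhds_zero_nat (1 : ℝ)).comp (tendsto_add_atTop_nat (j + 1))
    refine h.congr fun k => ?_
    have hk : ((k + j).factorial : ℝ) ≠ 0 := by positivity
    simp only [w, Function.comp_apply, norm_inv, Real.norm_natCast, Nat.succ_eq_add_one,
      show k + 1 + j = k + j + 1 by omega, Nat.factorial_succ]
    push_cast
    field_simp
    ring
  have hrad : (FormalMultilinearSeries.ofScalars A w).radius = ⊤ :=
    FormalMultilinearSeries.ofScalars_radius_eq_top_of_tendsto A w
      (Eventually.of_forall hw) hratio
  have hball := (FormalMultilinearSeries.ofScalars A w).hasFPowerSeriesOnBall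
    (by rw [hrad]; exact ENNReal.zero_lt_top)
  have hsum : (FormalMultilinearSeries.ofScalars A w).sum = vartheta (d := d) j :=
    FormalMultilinearSeries.ofScalarsSum_eq_tsum w
  rw [hrad, hsum] at hball
  refine AnalyticOnNhd.contDiff fun X _ => ?_
  exact hball.analyticAt_of_mem (by simp)

theorem vartheta_one_zero : vartheta (d := d) 1 0 = 1 := by
  rw [vartheta, tsum_eq_single 0 fun k hk => by
    rw [zero_pow hk]
    exact smul_zero (A := EuclideanSpace ℝ (Fin d) →L[ℝ] EuclideanSpace ℝ (Fin d))
      (((k + 1).factorial : ℝ)⁻¹)]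
  simp

theorem Phif_zero (f : EuclideanSpace ℝ (Fin d) → EuclideanSpace ℝ (Fin d))
    (ξ : EuclideanSpace ℝ (Fin d)) : Phif f ξ 0 = f ξ := by
  have h : (0 : ℝ) • fderiv ℝ f ξ = 0 := zero_smul ℝ (fderiv ℝ f ξ)
  rw [Phif, h, vartheta_one_zero, one_apply_eq_self]

theorem qf_zero (f : EuclideanSpace ℝ (Fin d) → EuclideanSpace ℝ (Fin d))
    (ξ : EuclideanSpace ℝ (Fin d)) : qf f ξ 0 0 = 0 := by
  simp [qf]

theorem kstage_eq (f : EuclideanSpace ℝ (Fin d) → EuclideanSpace ℝ (Fin d))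
    (c : ℕ → ℝ) (a : ℕ → ℕ → ℝ) (ξ : EuclideanSpace ℝ (Fin d)) (δ : ℝ) (i : ℕ) :
    kstage f c a ξ δ i =
      qf f ξ (c i * δ) (δ • ∑ j : Fin i, a i (j : ℕ) • kstage f c a ξ δ j) :=
  Nat.strongRecOn_eq _ _

theorem phiGamma_zero (f : EuclideanSpace ℝ (Fin d) → EuclideanSpace ℝ (Fin d))
    (c : ℕ → ℝ) (a : ℕ → ℕ → ℝ) (b : ℕ → ℝ) (s : ℕ) (ξ : EuclideanSpace ℝ (Fin d)) :
    phiGamma f c a b s ξ 0 = f ξ := by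
  have hk (i : ℕ) : kstage f c a ξ 0 i = 0 := by
    rw [kstage_eq, mul_zero, zero_smul, qf_zero]
  simp [phiGamma, Phif_zero, hk]

section Smoothness

variable {f : EuclideanSpace ℝ (Fin d) → EuclideanSpace ℝ (Fin d)} {n : WithTop ℕ∞}

theorem ContDiff.phif (hf : ContDiff ℝ (n + 1) f) :
    ContDiff ℝ n fun p : EuclideanSpace ℝ (Fin d) × ℝ => Phif f p.1 p.2 := by
  have hf' : ContDiff ℝ n (fderiv ℝ f) := hf.fderiv_right le_rfl
  have hf₀ : ContDiff ℝ n f := hf.of_le le_self_add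
  exact ((contDiff_vartheta 1 n).comp (contDiff_snd.smul (hf'.comp contDiff_fst))).clm_apply
    (hf₀.comp contDiff_fst)

theorem ContDiff.kstage (hf : ContDiff ℝ (n + 1) f) (c : ℕ → ℝ) (a : ℕ → ℕ → ℝ) (i : ℕ) :
    ContDiff ℝ n fun p : EuclideanSpace ℝ (Fin d) × ℝ => kstage f c a p.1 p.2 i := by
  induction i using Nat.strong_induction_on with
  | _ i ih =>
    have hf' : ContDiff ℝ n (fderiv ℝ f) := hf.fderiv_right le_rfl
    have hf₀ : ContDiff ℝ n f := hf.of_le le_self_add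
    have hδ : ContDiff ℝ n fun p : EuclideanSpace ℝ (Fin d) × ℝ => c i * p.2 :=
      contDiff_const.mul contDiff_snd
    have hΦ : ContDiff ℝ n fun p : EuclideanSpace ℝ (Fin d) × ℝ => Phif f p.1 (c i * p.2) :=
      ContDiff.comp_of_uncurried (F := Phif f) hf.phif contDiff_fst hδ
    have hu : ContDiff ℝ n fun p : EuclideanSpace ℝ (Fin d) × ℝ =>
        p.2 • ∑ j : Fin i, a i (j : ℕ) • _root_.kstage f c a p.1 p.2 j :=
      contDiff_snd.smul (ContDiff.sum fun j _ => (ih j j.isLt).const_smul (a i j))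
    have hDΦ : ContDiff ℝ n fun p : EuclideanSpace ℝ (Fin d) × ℝ =>
        fderiv ℝ f p.1 (Phif f p.1 (c i * p.2)) :=
      (hf'.comp contDiff_fst).clm_apply hΦ
    simp only [kstage_eq (i := i), qf]
    exact ((hf₀.fun_comp ((contDiff_fst.add (hδ.smul hΦ)).add hu)).sub
      (hδ.smul hDΦ)).sub (hf₀.fun_comp contDiff_fst)

theorem ContDiff.phiGamma (hf : ContDiff ℝ (n + 1) f) (c : ℕ → ℝ) (a : ℕ → ℕ → ℝ)
    (b : ℕ → ℝ) (s : ℕ) :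
    ContDiff ℝ n fun p : EuclideanSpace ℝ (Fin d) × ℝ => phiGamma f c a b s p.1 p.2 :=
  hf.phif.add (ContDiff.sum fun i _ => (hf.kstage c a i).const_smul (b i))

end Smoothness

theorem IsCompact.tendstoUniformlyOn_nhdsWithin_of_continuous {α β γ : Type*}
    [TopologicalSpace α] [TopologicalSpace β] [UniformSpace γ] {K : Set α} (hK : IsCompact K)
    {g : α × β → γ} (hg : Continuous g) (y : β) (t : Set β) :
    TendstoUniformlyOn (fun z x => g (x, z)) (fun x => g (x, y)) (𝓝[t] y) K := by
  intro u hu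
  have h := hK.mem_uniformity_of_prod (f := fun z x => g (x, z)) (s := Set.univ) (q := y)
    (by fun_prop) (Set.mem_univ y) (symm_le_uniformity hu)
  obtain ⟨v, hv, hvu⟩ := h
  rw [nhdsWithin_univ] at hv
  filter_upwards [mem_nhdsWithin_of_mem_nhds hv] with z hz x hx
  exact hvu z hz x hx

/-- If `γ > 2` and `f` is of class `C^{γ+1}`, then on every compact set
`K`, as `δ → 0⁺`, `φ_γ(·,δ) → f` uniformly on `K` and `D_ξ φ_γ(·,δ) → Df` uniformly
on `K`. -/
theorem llrk_increment_tendsto_uniformly (d s γ : ℕ) (hγ : 2 < γ)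
    (f : EuclideanSpace ℝ (Fin d) → EuclideanSpace ℝ (Fin d))
    (hf : ContDiff ℝ (γ + 1 : ℕ) f)
    (c : ℕ → ℝ) (a : ℕ → ℕ → ℝ) (b : ℕ → ℝ)
    (K : Set (EuclideanSpace ℝ (Fin d))) (hK : IsCompact K) :
    TendstoUniformlyOn (fun δ ξ => phiGamma f c a b s ξ δ) f
        (nhdsWithin 0 (Set.Ioi 0)) K
    ∧ TendstoUniformlyOn (fun δ ξ => fderiv ℝ (fun η => phiGamma f c a b s η δ) ξ)
        (fun ξ => fderiv ℝ f ξ) (nhdsWithin 0 (Set.Ioi 0)) K := by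
  have hG : ContDiff ℝ 1 fun p : EuclideanSpace ℝ (Fin d) × ℝ => phiGamma f c a b s p.1 p.2 := by
    have h : (γ + 1 : ℕ) = ((γ : WithTop ℕ∞) + 1) := by push_cast; rfl
    rw [h] at hf
    exact (hf.phiGamma c a b s).of_le (by exact_mod_cast (by omega : 1 ≤ γ))
  constructor
  · simpa only [phiGamma_zero] using
      hK.tendstoUniformlyOn_nhdsWithin_of_continuous hG.continuous 0 (Set.Ioi 0)
  · have hpartial : Continuous fun p : EuclideanSpace ℝ (Fin d) × ℝ =>
        fderiv ℝ (fun η => phiGamma f c a b s η p.2) p.1 :=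
      ContDiff.continuous_fderiv_left (F := phiGamma f c a b s) hG
    simpa only [phiGamma_zero] using
      hK.tendstoUniformlyOn_nhdsWithin_of_continuous hpartial 0 (Set.Ioi 0)

end
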